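/- arXiv:2203.01116 — 3 statements merged into one kernel-verified Lean document; each statement's English description precedes it below -/
import Mathlib

section
/- Let H be a real Hilbert space, let κ > 0, let (T_n : H → H)_{n∈ℕ} be a sequence of κ-attracting quasi-nonexpansive mappings such that C := ⋂_{n∈ℕ} Fix(T_n) ≠ ∅, and let (β_n y_n)_{n∈ℕ} be a sequence of bounded perturbations in H. Then for any bounded subset U ⊂ C, the sequence (x_n)_{n∈ℕ} generated by x_{n+1} = T_n(x_n + β_n y_n) from an arbitrary x_0 ∈ H satisfies: there exists a summable sequence (γ_n)_{n∈ℕ} of nonnegative reals such that for all z ∈ U and all n ∈ ℕ, ‖x_{n+1} − z‖² ≤ ‖x_n − z‖² − κ‖x_{n+1} − x_n‖² + γ_n. -/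
/-- For a sequence of `κ`-attracting quasi-nonexpansive mappings with
nonempty common fixed point set `C` and bounded perturbations `(β n • y n)`, the perturbed
iteration `x (n+1) = T n (x n + β n • y n)` satisfies, for every bounded subset `U ⊆ C`,
a quasi-Fejér-type inequality with an additional attracting term. -/
theorem apsm_kappaAttracting_perturbed_inequality
    {H : Type*} [NormedAddCommGroup H] [InnerProductSpace ℝ H] [CompleteSpace H]
    (κ : ℝ) (hκ : 0 < κ)
    (T : ℕ → H → H)
    (hTfix : ∀ n, {p : H | T n p = p}.Nonempty)
    (hTatt : ∀ n, ∀ p : H, ∀ z : H, T n z = z →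
      ‖T n p - z‖ ^ 2 ≤ ‖p - z‖ ^ 2 - κ * ‖p - T n p‖ ^ 2)
    (hC : (⋂ n, {p : H | T n p = p}).Nonempty)
    (β : ℕ → ℝ) (hβ : ∀ n, 0 ≤ β n) (hβsum : Summable β)
    (y : ℕ → H) (r : ℝ) (hy : ∀ n, ‖y n‖ ≤ r)
    (U : Set H) (hU : U ⊆ ⋂ n, {p : H | T n p = p}) (hUb : Bornology.IsBounded U)
    (x : ℕ → H) (hx : ∀ n, x (n + 1) = T n (x n + β n • y n)) :
    ∃ γ : ℕ → ℝ, (∀ n, 0 ≤ γ n) ∧ Summable γ ∧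
      ∀ z ∈ U, ∀ n, ‖x (n + 1) - z‖ ^ 2 ≤
        ‖x n - z‖ ^ 2 - κ * ‖x (n + 1) - x n‖ ^ 2 + γ n := by
  have hr : 0 ≤ r := (norm_nonneg _).trans (hy 0)
  obtain ⟨c, hc⟩ := hC
  have hc' : ∀ n, T n c = c := fun n => Set.mem_iInter.1 hc n
  obtain ⟨R, hR⟩ := (Metric.isBounded_iff_subset_closedBall c).1 hUb
  have he : ∀ n, ‖β n • y n‖ ≤ β n * r := fun n => by
    rw [norm_smul, Real.norm_of_nonneg (hβ n)]
    exact mul_le_mul_of_nonneg_left (hy n) (hβ n)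
  have hstep : ∀ n, ‖x (n + 1) - c‖ ≤ ‖x n - c‖ + β n * r := fun n => by
    have h1 := hTatt n (x n + β n • y n) c (hc' n)
    rw [← hx n] at h1
    have h2 : ‖x (n + 1) - c‖ ≤ ‖x n + β n • y n - c‖ := by
      refine (abs_le_of_sq_le_sq' ?_ (norm_nonneg _)).2
      have := mul_nonneg hκ.le (sq_nonneg ‖x n + β n • y n - x (n + 1)‖)
      linarith
    have h3 : x n + β n • y n - c = (x n - c) + β n • y n := by abel
    rw [h3] at h2
    linarith [norm_add_le (x n - c) (β n • y n), he n]
  have hind : ∀ n, ‖x n - c‖ ≤ ‖x 0 - c‖ + (∑ i ∈ Finset.range n, β i) * r := fun n => by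
    induction n with
    | zero => simp
    | succ k ih =>
      rw [Finset.sum_range_succ, add_mul]
      linarith [hstep k]
  obtain ⟨B, hB⟩ : ∃ B, B = (∑' i, β i) * r := ⟨_, rfl⟩
  have hB0 : 0 ≤ B := hB ▸ mul_nonneg (tsum_nonneg hβ) hr
  have hbB : ∀ n, β n * r ≤ B := fun n =>
    hB ▸ mul_le_mul_of_nonneg_right (hβsum.le_tsum n (fun j _ => hβ j)) hr
  obtain ⟨M, hM⟩ : ∃ M, M = ‖x 0 - c‖ + B := ⟨_, rfl⟩
  have hM0 : 0 ≤ M := by rw [hM]; positivity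
  have hxM : ∀ n, ‖x n - c‖ ≤ M := fun n => by
    have := mul_le_mul_of_nonneg_right (hβsum.sum_le_tsum (Finset.range n) (fun j _ => hβ j)) hr
    linarith [hind n]
  have hK : 0 ≤ 2 * (M + |R|) + 4 * κ * M + B * (1 + 3 * κ) := by positivity
  refine ⟨fun n => (β n * r) * (2 * (M + |R|) + 4 * κ * M + B * (1 + 3 * κ)),
    fun n => mul_nonneg (mul_nonneg (hβ n) hr) hK, (hβsum.mul_right r).mul_right _, ?_⟩
  intro z hz n
  have hzc : ‖z - c‖ ≤ |R| := by
    have := hR hz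
    rw [Metric.mem_closedBall, dist_eq_norm] at this
    exact this.trans (le_abs_self R)
  have h1 := hTatt n (x n + β n • y n) z (Set.mem_iInter.1 (hU hz) n)
  rw [← hx n] at h1
  have hb0 : 0 ≤ β n * r := mul_nonneg (hβ n) hr
  have hbn := hbB n
  have hen := he n
  have hD : ‖x n - z‖ ≤ M + |R| := by
    have h : x n - z = (x n - c) - (z - c) := by abel
    rw [h]
    linarith [norm_sub_le (x n - c) (z - c), hxM n]
  have hp : ‖x n + β n • y n - z‖ ≤ ‖x n - z‖ + β n * r := by
    have h : x n + β n • y n - z = (x n - z) + β n • y n := by abel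
    rw [h]
    linarith [norm_add_le (x n - z) (β n • y n)]
  have hq : ‖x (n + 1) - x n‖ ≤ ‖x n + β n • y n - x (n + 1)‖ + β n * r := by
    have h : x (n + 1) - x n = β n • y n - (x n + β n • y n - x (n + 1)) := by abel
    rw [h]
    linarith [norm_sub_le (β n • y n) (x n + β n • y n - x (n + 1))]
  have hq2 : ‖x n + β n • y n - x (n + 1)‖ ≤ 2 * M + β n * r := by
    have h : x n + β n • y n - x (n + 1) = (x n - c) + β n • y n - (x (n + 1) - c) := by abel
    rw [h]
    linarith [norm_sub_le ((x n - c) + β n • y n) (x (n + 1) - c),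
      norm_add_le (x n - c) (β n • y n), hxM n, hxM (n + 1)]
  have hp' := pow_le_pow_left₀ (norm_nonneg _) hp 2
  have hq' := mul_le_mul_of_nonneg_left (pow_le_pow_left₀ (norm_nonneg _) hq 2) hκ.le
  have e1 := mul_le_mul_of_nonneg_left hD hb0
  have e2 := mul_le_mul_of_nonneg_left (mul_le_mul_of_nonneg_left hq2 hb0) hκ.le
  have e3 := mul_le_mul_of_nonneg_left hbn hb0
  have e4 := mul_le_mul_of_nonneg_left e3 hκ.le
  dsimp only
  generalize β n * r = b at *
  nlinarith
end

section
/- Let H be a real Hilbert space and suppose a sequence (u_n)_{n∈ℕ} in H is quasi-Fejér monotone of Type-I relative to a nonempty closed convex set C ⊂ H. Suppose C has a nonempty relative interior with respect to a closed affine subspace V ⊂ H, i.e., there exist x_0 ∈ C ∩ V and ε > 0 such that {x ∈ V : ‖x − x_0‖ ≤ ε} ⊂ C. Then the sequence (P_V(u_n))_{n∈ℕ} converges strongly (in norm) to a point in V. -/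
theorem inner_zero_of_min {H : Type*} [NormedAddCommGroup H] [InnerProductSpace ℝ H]
    (w l : H) (h : ∀ t : ℝ, ‖w‖ ≤ ‖w - t • l‖) : inner ℝ w l = 0 := by
  have key : ∀ t : ℝ, 2 * t * inner ℝ w l ≤ t ^ 2 * ‖l‖ ^ 2 := by
    intro t
    have h1 : ‖w‖ ^ 2 ≤ ‖w - t • l‖ ^ 2 := by
      have := h t
      gcongr
    rw [norm_sub_sq_real, inner_smul_right, norm_smul, mul_pow, Real.norm_eq_abs, sq_abs] at h1
    linarith
  have hp : 0 < ‖l‖ ^ 2 + 1 := by positivity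
  have h2 := key (inner ℝ w l / (‖l‖ ^ 2 + 1))
  set i := inner ℝ w l
  set N := ‖l‖ ^ 2
  have h3 : 2 * i ^ 2 * (N + 1) ≤ i ^ 2 * N := by
    have e1 : 2 * (i / (N + 1)) * i = 2 * i ^ 2 * (N + 1) / (N + 1) ^ 2 := by
      field_simp
    have e2 : (i / (N + 1)) ^ 2 * N = i ^ 2 * N / (N + 1) ^ 2 := by
      field_simp
    rw [e1, e2] at h2
    exact (div_le_div_iff_of_pos_right (by positivity)).1 h2
  have hN : 0 ≤ N := by positivity
  have : i ^ 2 = 0 := by nlinarith [sq_nonneg i, mul_nonneg (sq_nonneg i) hN]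
  exact pow_eq_zero_iff (two_ne_zero) |>.1 this

/-- If a sequence `(u n)` in a real Hilbert space is quasi-Fejér monotone
of Type-I relative to a nonempty closed convex set `C` which has nonempty relative interior
with respect to a closed affine subspace `V` (a translate of a closed linear subspace), then
the projected sequence `(P_V (u n))` converges strongly to a point of `V`. -/
theorem quasiFejer_projection_onto_affine_converges
    {H : Type*} [NormedAddCommGroup H] [InnerProductSpace ℝ H] [CompleteSpace H]
    (C : Set H) (hCne : C.Nonempty) (hCc : IsClosed C) (hCconv : Convex ℝ C)
    (L : Submodule ℝ H) (hL : IsClosed (L : Set H)) (a : H)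
    (V : Set H) (hV : V = {p : H | p - a ∈ L})
    (PV : H → H) (hPV : ∀ p : H, PV p ∈ V ∧ ∀ w ∈ V, ‖p - PV p‖ ≤ ‖p - w‖)
    (u : ℕ → H)
    (hqf : ∃ ε : ℕ → ℝ, (∀ n, 0 ≤ ε n) ∧ Summable ε ∧
      ∀ z ∈ C, ∀ n, ‖u (n + 1) - z‖ ≤ ‖u n - z‖ + ε n)
    (x₀ : H) (hx₀ : x₀ ∈ C ∩ V)
    (ε : ℝ) (hε : 0 < ε)
    (hrelint : {p ∈ V | ‖p - x₀‖ ≤ ε} ⊆ C) :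
    ∃ q ∈ V, Filter.Tendsto (fun n => PV (u n)) Filter.atTop (nhds q) := by
  obtain ⟨e, he0, hes, hqf⟩ := hqf
  subst hV
  have hx0C := hx₀.1
  have hx0V : x₀ - a ∈ L := hx₀.2
  have hPL : ∀ p, PV p - a ∈ L := fun p => (hPV p).1
  have horth : ∀ p, ∀ l ∈ L, inner ℝ (p - PV p) l = 0 := by
    intro p l hl
    apply inner_zero_of_min
    intro t
    have h := (hPV p).2 (PV p + t • l) (by
      have := L.add_mem (hPL p) (L.smul_mem t hl)
      show PV p + t • l - a ∈ L
      convert this using 1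
      abel)
    rwa [← sub_sub] at h
  set E := ∑' n, e n with hE
  have hE0 : 0 ≤ E := tsum_nonneg he0
  have hpart : ∀ n, ∑ i ∈ Finset.range n, e i ≤ E := fun n =>
    hes.sum_le_tsum _ (fun i _ => he0 i)
  have heE : ∀ n, e n ≤ E := fun n => hes.le_tsum n (fun i _ => he0 i)
  have hb : ∀ n, ‖u n - x₀‖ ≤ ‖u 0 - x₀‖ + ∑ i ∈ Finset.range n, e i := by
    intro n
    induction n with
    | zero => simp
    | succ k ih =>
      rw [Finset.sum_range_succ]
      linarith [hqf x₀ hx0C k]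
  set B := ‖u 0 - x₀‖ + E + ε with hB
  set M := 2 * B + E with hM
  have hM0 : 0 ≤ M := by positivity
  have hstep : ∀ n, 2 * ε * ‖PV (u (n + 1)) - PV (u n)‖ ≤
      ‖u n - x₀‖ ^ 2 - ‖u (n + 1) - x₀‖ ^ 2 + M * e n := by
    intro n
    set d := PV (u (n + 1)) - PV (u n) with hd
    have hdL : d ∈ L := by
      have := L.sub_mem (hPL (u (n + 1))) (hPL (u n))
      convert this using 1
      rw [hd]; abel
    set s := (ε / ‖d‖) • d with hs
    have hsL : s ∈ L := L.smul_mem _ hdL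
    have hsn : ‖s‖ ≤ ε := by
      rw [hs, norm_smul, Real.norm_eq_abs, abs_of_nonneg (by positivity)]
      by_cases h : ‖d‖ = 0
      · simp [h, hε.le]
      · rw [div_mul_cancel₀ _ h]
    have hds : inner ℝ d s = ε * ‖d‖ := by
      rw [hs, inner_smul_right, real_inner_self_eq_norm_sq]
      by_cases h : ‖d‖ = 0
      · simp [h]
      · field_simp
    have hz : x₀ - s ∈ C := by
      apply hrelint
      refine ⟨?_, by simpa using hsn⟩
      show x₀ - s - a ∈ L
      convert L.sub_mem hx0V hsL using 1
      abel
    have h1 := hqf _ hz n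
    have r : ∀ m, u m - (x₀ - s) = (u m - x₀) + s := fun m => by abel
    rw [r, r] at h1
    have h2 : ‖u n - x₀ + s‖ ≤ B := by
      linarith [norm_add_le (u n - x₀) s, hb n, hpart n]
    have h3 : ‖u (n + 1) - x₀ + s‖ ^ 2 ≤ (‖u n - x₀ + s‖ + e n) ^ 2 := by gcongr
    have h4 : (‖u n - x₀ + s‖ + e n) ^ 2 ≤ ‖u n - x₀ + s‖ ^ 2 + M * e n := by
      nlinarith [mul_le_mul_of_nonneg_right h2 (he0 n),
        mul_le_mul_of_nonneg_right (heE n) (he0 n)]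
    have h5 := h3.trans h4
    rw [norm_add_sq_real, norm_add_sq_real] at h5
    have h6 : inner ℝ (u (n + 1) - x₀) s - inner ℝ (u n - x₀) s = ε * ‖d‖ := by
      rw [← hds, ← inner_sub_left]
      have : u (n + 1) - x₀ - (u n - x₀) =
          (u (n + 1) - PV (u (n + 1))) - (u n - PV (u n)) + d := by
        rw [hd]; abel
      rw [this, inner_add_left, inner_sub_left, horth _ s hsL, horth _ s hsL]
      simp
    linarith
  have hsum : Summable fun n => ‖PV (u (n + 1)) - PV (u n)‖ := by
    apply summable_of_sum_range_le (c := (‖u 0 - x₀‖ ^ 2 + M * E) / (2 * ε))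
    · intro n; positivity
    · intro n
      rw [le_div_iff₀ (by positivity), mul_comm]
      have h1 := Finset.sum_le_sum (s := Finset.range n) (fun i _ => hstep i)
      rw [Finset.sum_add_distrib, Finset.sum_range_sub' (fun i => ‖u i - x₀‖ ^ 2),
        ← Finset.mul_sum, ← Finset.mul_sum] at h1
      nlinarith [mul_le_mul_of_nonneg_left (hpart n) hM0, sq_nonneg ‖u n - x₀‖]
  have hcau : CauchySeq fun n => PV (u n) := by
    apply cauchySeq_of_summable_dist
    convert hsum using 2 with n
    rw [dist_comm, dist_eq_norm]
  obtain ⟨q, hq⟩ := cauchySeq_tendsto_of_complete hcau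
  refine ⟨q, ?_, hq⟩
  exact hL.mem_of_tendsto (hq.sub_const a) (Filter.Eventually.of_forall fun n => hPL (u n))
end

section
/- Let H be a real Hilbert space, let (u_n)_{n∈ℕ} be quasi-Fejér monotone of Type-I relative to a nonempty closed convex set C ⊂ H, and suppose there exist x_0 ∈ C ∩ V and ε > 0 such that {x ∈ V : ‖x − x_0‖ ≤ ε} ⊂ C, where V ⊂ H is a closed affine subspace. Then there exists a summable sequence (γ_n)_{n∈ℕ} of nonnegative reals such that for all n ∈ ℕ, 2ε‖P_V(u_n) − P_V(u_{n+1})‖ ≤ ‖u_n − x_0‖² − ‖u_{n+1} − x_0‖² + γ_n. -/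
lemma orth_aux {H : Type*} [NormedAddCommGroup H] [InnerProductSpace ℝ H] (q w : H)
    (h : ∀ t : ℝ, ‖q‖ ≤ ‖q - t • w‖) : inner ℝ q w = 0 := by
  have hN : 0 < ‖w‖ ^ 2 + 1 := by positivity
  set s : ℝ := inner ℝ q w with hs
  have h1 := h (s / (‖w‖ ^ 2 + 1))
  have h2 := pow_le_pow_left₀ (norm_nonneg q) h1 2
  rw [norm_sub_sq_real, inner_smul_right, norm_smul, mul_pow, Real.norm_eq_abs, sq_abs, ← hs] at h2
  set t := s / (‖w‖ ^ 2 + 1) with ht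
  have hst : s = t * (‖w‖ ^ 2 + 1) := by rw [ht]; field_simp
  rw [hst] at h2
  have h3 : t ^ 2 * (‖w‖ ^ 2 + 2) ≤ 0 := by nlinarith
  have h4 : t ^ 2 = 0 := by
    have := sq_nonneg t
    nlinarith [mul_nonneg this (sq_nonneg ‖w‖)]
  have h5 : t = 0 := by simpa using h4
  rw [hst, h5, zero_mul]

/-- Under the assumptions of Lemma 1 (quasi-Fejér Type-I sequence relative
to a closed convex set `C` having relative interior with respect to a closed affine subspace
`V`), there is a summable nonnegative sequence `(γ n)` such that
`2ε‖P_V (u n) − P_V (u (n+1))‖ ≤ ‖u n − x₀‖² − ‖u (n+1) − x₀‖² + γ n` for all `n`. -/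
theorem quasiFejer_projection_onto_affine_key_inequality
    {H : Type*} [NormedAddCommGroup H] [InnerProductSpace ℝ H] [CompleteSpace H]
    (C : Set H) (hCne : C.Nonempty) (hCc : IsClosed C) (hCconv : Convex ℝ C)
    (L : Submodule ℝ H) (hL : IsClosed (L : Set H)) (a : H)
    (V : Set H) (hV : V = {p : H | p - a ∈ L})
    (PV : H → H) (hPV : ∀ p : H, PV p ∈ V ∧ ∀ w ∈ V, ‖p - PV p‖ ≤ ‖p - w‖)
    (u : ℕ → H)
    (hqf : ∃ ε : ℕ → ℝ, (∀ n, 0 ≤ ε n) ∧ Summable ε ∧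
      ∀ z ∈ C, ∀ n, ‖u (n + 1) - z‖ ≤ ‖u n - z‖ + ε n)
    (x₀ : H) (hx₀ : x₀ ∈ C ∩ V)
    (ε : ℝ) (hε : 0 < ε)
    (hrelint : {p ∈ V | ‖p - x₀‖ ≤ ε} ⊆ C) :
    ∃ γ : ℕ → ℝ, (∀ n, 0 ≤ γ n) ∧ Summable γ ∧
      ∀ n, 2 * ε * ‖PV (u n) - PV (u (n + 1))‖ ≤
        ‖u n - x₀‖ ^ 2 - ‖u (n + 1) - x₀‖ ^ 2 + γ n := by
  obtain ⟨e, he0, hes, hq⟩ := hqf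
  subst hV
  have horth : ∀ p : H, ∀ w ∈ L, inner ℝ (p - PV p) w = 0 := by
    intro p w hw
    apply orth_aux
    intro t
    have h1 : PV p + t • w ∈ {p : H | p - a ∈ L} := by
      have h2 : PV p - a ∈ L := (hPV p).1
      have h3 := L.add_mem h2 (L.smul_mem t hw)
      change PV p + t • w - a ∈ L
      convert h3 using 1
      abel
    have h4 := (hPV p).2 _ h1
    rwa [← sub_sub] at h4
  have hB : ∀ n, ‖u n - x₀‖ ≤ ‖u 0 - x₀‖ + ∑ i ∈ Finset.range n, e i := by
    intro n
    induction n with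
    | zero => simp
    | succ k ih =>
      rw [Finset.sum_range_succ]
      linarith [hq x₀ hx₀.1 k]
  set S := ∑' i, e i with hS
  have hS0 : 0 ≤ S := tsum_nonneg he0
  have hB' : ∀ n, ‖u n - x₀‖ ≤ ‖u 0 - x₀‖ + S := fun n => by
    linarith [hB n, hes.sum_le_tsum (Finset.range n) (fun i _ => he0 i)]
  have heS : ∀ n, e n ≤ S := fun n => hes.le_tsum n (fun i _ => he0 i)
  refine ⟨fun n => (2 * (‖u 0 - x₀‖ + S + ε) + S) * e n, ?_, hes.mul_left _, ?_⟩
  · intro n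
    have := he0 n
    positivity
  intro n
  set d := PV (u n) - PV (u (n + 1)) with hd
  have hdL : d ∈ L := by
    have h1 : PV (u n) - a ∈ L := (hPV _).1
    have h2 : PV (u (n + 1)) - a ∈ L := (hPV _).1
    have h3 := L.sub_mem h1 h2
    rwa [sub_sub_sub_cancel_right] at h3
  set v := (ε * ‖d‖⁻¹) • d with hv
  have hvL : v ∈ L := L.smul_mem _ hdL
  have hvn : ‖v‖ ≤ ε := by
    rw [hv, norm_smul, Real.norm_of_nonneg (by positivity), mul_assoc]
    have := inv_mul_le_one (a := ‖d‖)
    nlinarith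
  have hdv : inner ℝ d v = ε * ‖d‖ := by
    rw [hv, inner_smul_right, real_inner_self_eq_norm_sq]
    by_cases h : ‖d‖ = 0
    · simp [h]
    · field_simp
  have huv : inner ℝ (u n - x₀) v - inner ℝ (u (n + 1) - x₀) v = ε * ‖d‖ := by
    rw [← hdv, ← inner_sub_left]
    have h1 := horth (u n) v hvL
    have h2 := horth (u (n + 1)) v hvL
    have h3 : u n - x₀ - (u (n + 1) - x₀)
        = d + (u n - PV (u n)) - (u (n + 1) - PV (u (n + 1))) := by
      rw [hd]; abel
    rw [h3, inner_sub_left, inner_add_left, h1, h2]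
    ring
  have hz : x₀ + v ∈ C := by
    apply hrelint
    refine ⟨?_, by simpa using hvn⟩
    have h1 : x₀ - a ∈ L := hx₀.2
    have h3 := L.add_mem h1 hvL
    change x₀ + v - a ∈ L
    convert h3 using 1
    abel
  have hk := hq _ hz n
  rw [← sub_sub, ← sub_sub] at hk
  have hk2 := pow_le_pow_left₀ (norm_nonneg _) hk 2
  rw [add_sq, norm_sub_sq_real, norm_sub_sq_real (u n - x₀)] at hk2
  have hb : ‖u n - x₀ - v‖ ≤ ‖u 0 - x₀‖ + S + ε := by
    linarith [norm_sub_le (u n - x₀) v, hB' n]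
  have g1 := mul_le_mul_of_nonneg_right hb (he0 n)
  have g2 := mul_le_mul_of_nonneg_right (heS n) (he0 n)
  change _ ≤ _ + (2 * (‖u 0 - x₀‖ + S + ε) + S) * e n
  nlinarith
end
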